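/- Let T > 0 and C > 0. For each n ∈ ℕ let s^n, i^n : [0,T]×[0,1] → [0,1] be measurable and satisfy ‖s^n(t,·) − s^n(τ,·)‖_{L²(0,1)} ≤ C·√|t−τ| and ‖i^n(t,·) − i^n(τ,·)‖_{L²(0,1)} ≤ C·√|t−τ| for all t, τ ∈ [0,T]. Let s, i : [0,T]×[0,1] → [0,1] be measurable and satisfy the same estimates ‖s(t,·) − s(τ,·)‖_{L²(0,1)} ≤ C·√|t−τ| and ‖i(t,·) − i(τ,·)‖_{L²(0,1)} ≤ C·√|t−τ|, and assume that s^n → s and i^n → i weakly* in L^∞([0,T]×[0,1]), i.e. ∫₀^T∫₀¹ s^n g dx dt → ∫₀^T∫₀¹ s g dx dt and ∫₀^T∫₀¹ i^n g dx dt → ∫₀^T∫₀¹ i g dx dt for every g ∈ L¹([0,T]×[0,1]). Then for every ψ ∈ L²([0,T]×[0,1]²): ∫₀^T∫₀¹∫₀¹ ψ(t,x,y)·s^n(t,x)·i^n(t,y) dx dy dt → ∫₀^T∫₀¹∫₀¹ ψ(t,x,y)·s(t,x)·i(t,y) dx dy dt as n → ∞. -/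

import Mathlib

open MeasureTheory Real Filter Set

noncomputable section

/-- The subinterval `I^n_j = (j/n, (j+1)/n)` of `(0,1)`, for `j : Fin n`
(corresponding to `((j-1)/n, j/n)` in one-based indexing). -/
def Inj (n : ℕ) (j : Fin n) : Set ℝ := Set.Ioo ((j : ℝ) / n) (((j : ℝ) + 1) / n)

/-- Step function on `[0,1]` associated with a vector `v : Fin n → ℝ`. -/
def stepFn (n : ℕ) (v : Fin n → ℝ) (x : ℝ) : ℝ :=
  ∑ j : Fin n, Set.indicator (Inj n j) (fun _ => v j) x

/-- Step kernel (step graphon) on `[0,1]²` associated with a matrix. -/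
def stepKer (n : ℕ) (A : Fin n → Fin n → ℝ) (x y : ℝ) : ℝ :=
  ∑ j : Fin n, ∑ k : Fin n,
    Set.indicator (Inj n j) (fun _ => Set.indicator (Inj n k) (fun _ => A j k) y) x

/-- Average `⟨u⟩_{I^n_j} = n ∫_{I^n_j} u`. -/
def avg1 (n : ℕ) (j : Fin n) (u : ℝ → ℝ) : ℝ := (n : ℝ) * ∫ x in Inj n j, u x

/-- Average `⟨U⟩_{I^n_j × I^n_k} = n² ∬_{I^n_j × I^n_k} U`. -/
def avg2 (n : ℕ) (j k : Fin n) (U : ℝ → ℝ → ℝ) : ℝ :=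
  (n : ℝ) ^ 2 * ∫ x in Inj n j, ∫ y in Inj n k, U x y

/-- Carathéodory (integral-form) solutions of the graph SIR system on a time set `J`. -/
def IsGraphSIRSol (n : ℕ) (J : Set ℝ) (β γ : Fin n → ℝ → ℝ)
    (A : Fin n → Fin n → ℝ → ℝ) (s i r : Fin n → ℝ → ℝ) : Prop :=
  (∀ j : Fin n, ContinuousOn (s j) J ∧ ContinuousOn (i j) J ∧ ContinuousOn (r j) J) ∧
  ∀ j : Fin n, ∀ t ∈ J,
    (s j t = s j 0 - ∫ τ in (0:ℝ)..t,
        s j τ * (1 / (n : ℝ) * ∑ k : Fin n, β k τ * A j k τ * i k τ)) ∧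
    (i j t = i j 0 + ∫ τ in (0:ℝ)..t,
        (s j τ * (1 / (n : ℝ) * ∑ k : Fin n, β k τ * A j k τ * i k τ) - γ j τ * i j τ)) ∧
    (r j t = r j 0 + ∫ τ in (0:ℝ)..t, γ j τ * i j τ)

/-- Smooth test functions on `[0,T) × [0,1]` (vanishing for `t` close to `T`). -/
def IsTest (T : ℝ) (φ : ℝ → ℝ → ℝ) : Prop :=
  ContDiff ℝ (⊤ : ℕ∞) (fun p : ℝ × ℝ => φ p.1 p.2) ∧ ∃ T' : ℝ, T' < T ∧ ∀ t x : ℝ, T' ≤ t → φ t x = 0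

/-- Distributional solutions of the continuum SIR system on `[0,T] × [0,1]`
with kernel `W`, coefficients `β, γ` and initial data `(s₀, i₀, r₀)`. -/
def IsDistribSol (T : ℝ) (W : ℝ → ℝ → ℝ → ℝ) (β γ : ℝ → ℝ → ℝ)
    (s0 i0 r0 : ℝ → ℝ) (s i r : ℝ → ℝ → ℝ) : Prop :=
  Measurable (fun p : ℝ × ℝ => s p.1 p.2) ∧
  Measurable (fun p : ℝ × ℝ => i p.1 p.2) ∧
  Measurable (fun p : ℝ × ℝ => r p.1 p.2) ∧
  (∀ φ : ℝ → ℝ → ℝ, IsTest T φ →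
    (∫ t in Set.Icc (0:ℝ) T, ∫ x in Set.Icc (0:ℝ) 1,
        s t x * (deriv (fun τ => φ τ x) t
          - φ t x * ∫ y in Set.Icc (0:ℝ) 1, β t y * W t x y * i t y))
      + (∫ x in Set.Icc (0:ℝ) 1, s0 x * φ 0 x) = 0) ∧
  (∀ ψ : ℝ → ℝ → ℝ, IsTest T ψ →
    (∫ t in Set.Icc (0:ℝ) T, ∫ x in Set.Icc (0:ℝ) 1,
        (i t x * (deriv (fun τ => ψ τ x) t - γ t x * ψ t x)
          + s t x * ψ t x * ∫ y in Set.Icc (0:ℝ) 1, β t y * W t x y * i t y))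
      + (∫ x in Set.Icc (0:ℝ) 1, i0 x * ψ 0 x) = 0) ∧
  (∀ η : ℝ → ℝ → ℝ, IsTest T η →
    (∫ t in Set.Icc (0:ℝ) T, ∫ x in Set.Icc (0:ℝ) 1,
        (r t x * deriv (fun τ => η τ x) t + γ t x * η t x * i t x))
      + (∫ x in Set.Icc (0:ℝ) 1, r0 x * η 0 x) = 0)

/-- The cut norm of a kernel on `[0,1]²`. -/
def cutNorm (U : ℝ → ℝ → ℝ) : ℝ :=
  sSup { c : ℝ | ∃ S T : Set ℝ, MeasurableSet S ∧ MeasurableSet T ∧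
    S ⊆ Set.Icc 0 1 ∧ T ⊆ Set.Icc 0 1 ∧ c = |∫ x in S, ∫ y in T, U x y| }

/-- `L²(0,1)` distance. -/
def L2dist (f g : ℝ → ℝ) : ℝ := Real.sqrt (∫ x in Set.Icc (0:ℝ) 1, (f x - g x) ^ 2)

/-- `L¹(0,1)` distance. -/
def L1dist (f g : ℝ → ℝ) : ℝ := ∫ x in Set.Icc (0:ℝ) 1, |f x - g x|


lemma auxInt {α : Type*} [MeasurableSpace α] (μ : Measure α) [IsFiniteMeasure μ] (f : α → ℝ)
    (hf : Measurable f) (h2 : Integrable (fun x => f x ^ 2) μ) : Integrable f μ := by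
  refine Integrable.mono' (h2.add (integrable_const (1:ℝ))) hf.aestronglyMeasurable ?_
  refine Eventually.of_forall fun x => ?_
  simp only [Pi.add_apply, Real.norm_eq_abs]
  rw [abs_le]; constructor <;> nlinarith [sq_nonneg (f x - 1), sq_nonneg (f x + 1)]

lemma auxMul {α : Type*} [MeasurableSpace α] (μ : Measure α) (f w : α → ℝ)
    (hw : Measurable w) (hb : ∀ᵐ x ∂μ, |w x| ≤ 1) (h2 : Integrable f μ) :
    Integrable (fun x => w x * f x) μ := by
  refine h2.bdd_mul (c := 1) hw.aestronglyMeasurable ?_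
  simpa using hb

lemma coreA (T : ℝ) (hT : 0 < T) (L : ℝ) (hL : 0 < L) (w : ℕ → ℝ → ℝ → ℝ)
    (hm : ∀ n, Measurable (fun p : ℝ × ℝ => w n p.1 p.2))
    (hb : ∀ n, ∀ t ∈ Icc 0 T, ∀ x ∈ Icc (0:ℝ) 1, |w n t x| ≤ 1)
    (hh : ∀ n, ∀ t ∈ Icc 0 T, ∀ τ ∈ Icc 0 T,
      ∫ x in Icc (0:ℝ) 1, (w n t x - w n τ x) ^ 2 ≤ L * |t - τ|)
    (hweak : ∀ g : ℝ → ℝ → ℝ,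
      IntegrableOn (fun p : ℝ × ℝ => g p.1 p.2)
        (Set.Icc 0 T ×ˢ Set.Icc (0:ℝ) 1) (volume : Measure (ℝ × ℝ)) →
      Tendsto (fun n => ∫ p in (Set.Icc 0 T ×ˢ Set.Icc (0:ℝ) 1),
          w n p.1 p.2 * g p.1 p.2 ∂(volume : Measure (ℝ × ℝ))) atTop (nhds 0))
    (t : ℝ) (ht : t ∈ Icc 0 T) (g : ℝ → ℝ) (hg : Measurable g)
    (hg2 : IntegrableOn (fun x => g x ^ 2) (Icc (0:ℝ) 1)) :
    Tendsto (fun n => ∫ x in Icc (0:ℝ) 1, w n t x * g x) atTop (nhds 0) := by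
  have hgi : Integrable g (volume.restrict (Icc (0:ℝ) 1)) := auxInt _ g hg hg2
  have hms : ∀ n t, Measurable (w n t) := fun n t => (hm n).comp measurable_prodMk_left
  have hbae : ∀ n, ∀ t ∈ Icc 0 T, ∀ᵐ x ∂(volume.restrict (Icc (0:ℝ) 1)), |w n t x| ≤ 1 := by
    intro n t ht
    filter_upwards [ae_restrict_mem measurableSet_Icc] with x hx using hb n t ht x hx
  have hwi : ∀ n, ∀ t ∈ Icc 0 T, Integrable (fun x => w n t x * g x)
      (volume.restrict (Icc (0:ℝ) 1)) := fun n t ht =>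
    auxMul _ _ _ (hms n t) (hbae n t ht) hgi
  set G : ℝ := ∫ x in Icc (0:ℝ) 1, g x ^ 2 with hG
  have hG0 : 0 ≤ G := integral_nonneg fun x => sq_nonneg _
  -- equicontinuity estimate
  have heq : ∀ n, ∀ τ ∈ Icc 0 T, ∀ δ > 0,
      |(∫ x in Icc (0:ℝ) 1, w n t x * g x) - ∫ x in Icc (0:ℝ) 1, w n τ x * g x|
        ≤ δ * G + δ⁻¹ * (L * |t - τ|) := by
    intro n τ hτ δ hδ
    rw [← integral_sub (hwi n t ht) (hwi n τ hτ)]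
    have hsq : Integrable (fun x => (w n t x - w n τ x) ^ 2) (volume.restrict (Icc (0:ℝ) 1)) := by
      refine Integrable.mono' (integrable_const (4:ℝ))
        (((hms n t).sub (hms n τ)).pow_const 2).aestronglyMeasurable ?_
      filter_upwards [hbae n t ht, hbae n τ hτ] with x h1 h2
      rw [abs_le] at h1 h2
      rw [Real.norm_eq_abs, abs_of_nonneg (sq_nonneg _)]
      nlinarith
    calc |∫ x in Icc (0:ℝ) 1, (w n t x * g x - w n τ x * g x)|
        ≤ ∫ x in Icc (0:ℝ) 1, (δ * g x ^ 2 + δ⁻¹ * (w n t x - w n τ x) ^ 2) := by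
          rw [← Real.norm_eq_abs]
          refine norm_integral_le_of_norm_le ((hg2.const_mul δ).add (hsq.const_mul _)) ?_
          refine Eventually.of_forall fun x => ?_
          rw [← sub_mul, Real.norm_eq_abs]
          set a := w n t x - w n τ x
          have h1 : δ * g x ^ 2 + δ⁻¹ * a ^ 2 = δ⁻¹ * ((δ * g x)^2 + a^2) := by
            field_simp
          have h2 : a * g x = δ⁻¹ * (a * (δ * g x)) := by field_simp
          rw [h1, h2, abs_mul, abs_of_pos (inv_pos.2 hδ)]
          refine mul_le_mul_of_nonneg_left ?_ (inv_pos.2 hδ).le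
          rw [abs_le]; constructor <;> nlinarith [sq_nonneg (a - δ * g x), sq_nonneg (a + δ * g x)]
      _ = δ * G + δ⁻¹ * ∫ x in Icc (0:ℝ) 1, (w n t x - w n τ x) ^ 2 := by
          rw [integral_add (hg2.const_mul δ) (hsq.const_mul _), integral_const_mul, integral_const_mul]
      _ ≤ _ := by
          have := hh n t ht τ hτ
          gcongr
  rw [Metric.tendsto_atTop]
  intro ε hε
  -- choose parameters
  obtain ⟨δ, hδ, hδG⟩ : ∃ δ > 0, δ * G ≤ ε / 4 := by
    refine ⟨ε / 4 / (G + 1), by positivity, ?_⟩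
    rw [div_mul_eq_mul_div, div_le_iff₀ (by positivity)]
    nlinarith
  obtain ⟨η, hη, hηL⟩ : ∃ η > 0, δ⁻¹ * (L * η) ≤ ε / 4 := by
    refine ⟨ε / 4 * δ / L, by positivity, le_of_eq ?_⟩
    field_simp
  set a := max 0 (t - η)
  set b := min T (t + η)
  have hab : a < b := by
    obtain ⟨h0, h1⟩ := ht
    simp only [a, b, max_lt_iff, lt_min_iff]
    refine ⟨⟨hT, ?_⟩, ?_, ?_⟩ <;> linarith
  have hJ : Icc a b ⊆ Icc 0 T := Icc_subset_Icc (le_max_left _ _) (min_le_left _ _)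
  have hnear : ∀ τ ∈ Icc a b, |t - τ| ≤ η := by
    intro τ hτ
    have h1 : t - η ≤ τ := (le_max_right _ _).trans hτ.1
    have h2 : τ ≤ t + η := hτ.2.trans (min_le_right _ _)
    rw [abs_le]; constructor <;> linarith
  have hest : ∀ n, ∀ τ ∈ Icc a b,
      |(∫ x in Icc (0:ℝ) 1, w n t x * g x) - ∫ x in Icc (0:ℝ) 1, w n τ x * g x| ≤ ε / 2 := by
    intro n τ hτ
    refine (heq n τ (hJ hτ) δ hδ).trans ?_
    have : δ⁻¹ * (L * |t - τ|) ≤ δ⁻¹ * (L * η) := by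
      have := hnear τ hτ
      gcongr
    linarith
  -- weak limit
  have hgprod : Integrable (fun p : ℝ × ℝ => g p.2)
      ((volume.restrict (Icc 0 T)).prod (volume.restrict (Icc (0:ℝ) 1))) := hgi.comp_snd _
  have hind : Integrable (fun p : ℝ × ℝ => (Icc a b).indicator (fun _ => (1:ℝ)) p.1 * g p.2)
      ((volume.restrict (Icc 0 T)).prod (volume.restrict (Icc (0:ℝ) 1))) := by
    refine auxMul _ (fun p : ℝ × ℝ => g p.2) (fun p => (Icc a b).indicator (fun _ => (1:ℝ)) p.1)
      ((measurable_const.indicator measurableSet_Icc).comp measurable_fst) ?_ hgprod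
    refine Eventually.of_forall fun p => ?_
    by_cases h : p.1 ∈ Icc a b <;> simp [indicator, h]
  have hw := hweak (fun τ x => (Icc a b).indicator (fun _ => (1:ℝ)) τ * g x) (by
    rw [IntegrableOn, Measure.volume_eq_prod, ← Measure.prod_restrict]; exact hind)
  have hbprod : ∀ n, ∀ᵐ p : ℝ × ℝ ∂((volume.restrict (Icc 0 T)).prod
      (volume.restrict (Icc (0:ℝ) 1))), |w n p.1 p.2| ≤ 1 := by
    intro n
    rw [Measure.prod_restrict]
    filter_upwards [ae_restrict_mem (measurableSet_Icc.prod measurableSet_Icc)] with p hp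
    exact hb n _ hp.1 _ hp.2
  have hwrep : ∀ n, ∫ p in (Set.Icc 0 T ×ˢ Set.Icc (0:ℝ) 1),
      w n p.1 p.2 * ((Icc a b).indicator (fun _ => (1:ℝ)) p.1 * g p.2) ∂(volume : Measure (ℝ × ℝ))
      = ∫ τ in Icc a b, ∫ x in Icc (0:ℝ) 1, w n τ x * g x := by
    intro n
    rw [Measure.volume_eq_prod, ← Measure.prod_restrict, integral_prod _
      (auxMul _ _ (fun p : ℝ × ℝ => w n p.1 p.2) (hm n) (hbprod n) hind)]
    have : ∀ τ, ∫ x in Icc (0:ℝ) 1, w n τ x * ((Icc a b).indicator (fun _ => (1:ℝ)) τ * g x)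
        = (Icc a b).indicator (fun τ => ∫ x in Icc (0:ℝ) 1, w n τ x * g x) τ := by
      intro τ
      by_cases h : τ ∈ Icc a b <;> simp only [indicator, h] <;> simp
    simp only [this]
    rw [setIntegral_indicator measurableSet_Icc, inter_eq_self_of_subset_right hJ]
  simp only [hwrep] at hw
  have hDint : ∀ n, IntegrableOn (fun τ => ∫ x in Icc (0:ℝ) 1, w n τ x * g x) (Icc a b) := by
    intro n
    have := (auxMul _ _ (fun p : ℝ × ℝ => w n p.1 p.2) (hm n) (hbprod n) hgprod).integral_prod_left
    exact IntegrableOn.mono_set this hJ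
  rw [Metric.tendsto_atTop] at hw
  obtain ⟨N, hN⟩ := hw ((b - a) * (ε / 2)) (by have := sub_pos.2 hab; positivity)
  refine ⟨N, fun n hn => ?_⟩
  have h1 := hN n hn
  rw [Real.dist_eq, sub_zero] at h1 ⊢
  set D := ∫ x in Icc (0:ℝ) 1, w n t x * g x
  have h2 : |(b - a) * D - ∫ τ in Icc a b, ∫ x in Icc (0:ℝ) 1, w n τ x * g x|
      ≤ (b - a) * (ε / 2) := by
    have e1 : (b - a) * D = ∫ τ in Icc a b, D := by
      simp [hab.le]
    rw [e1, ← integral_sub (by simp) (hDint n)]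
    have := norm_setIntegral_le_of_norm_le_const (μ := volume) (s := Icc a b) (C := ε / 2)
      (f := fun τ => D - ∫ x in Icc (0:ℝ) 1, w n τ x * g x) (by simp) (fun τ hτ => hest n τ hτ)
    simp [hab.le] at this
    simpa [mul_comm] using this
  have h3 : (b - a) * |D| < (b - a) * ε := by
    rw [← abs_of_pos (sub_pos.2 hab), ← abs_mul, abs_of_pos (sub_pos.2 hab)]
    rw [abs_lt] at h1 ⊢
    rw [abs_le] at h2
    constructor <;> linarith [h1.1, h1.2, h2.1, h2.2]
  exact lt_of_mul_lt_mul_left h3 (sub_pos.2 hab).le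

lemma coreB (ν : Measure ℝ) [IsFiniteMeasure ν] (hν : ν univ = 1)
    (an bn : ℕ → ℝ → ℝ) (a b : ℝ → ℝ)
    (ham : ∀ n, Measurable (an n)) (hbm : ∀ n, Measurable (bn n))
    (ham' : Measurable a) (hbm' : Measurable b)
    (hab : ∀ n, ∀ᵐ x ∂ν, |an n x| ≤ 1) (hbb : ∀ n, ∀ᵐ x ∂ν, |bn n x| ≤ 1)
    (hab' : ∀ᵐ x ∂ν, |a x| ≤ 1) (hbb' : ∀ᵐ x ∂ν, |b x| ≤ 1)
    (ha : ∀ g : ℝ → ℝ, Measurable g → Integrable (fun x => g x ^ 2) ν →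
      Tendsto (fun n => ∫ x, an n x * g x ∂ν) atTop (nhds (∫ x, a x * g x ∂ν)))
    (hb : ∀ g : ℝ → ℝ, Measurable g → Integrable (fun x => g x ^ 2) ν →
      Tendsto (fun n => ∫ x, bn n x * g x ∂ν) atTop (nhds (∫ x, b x * g x ∂ν)))
    (ψ : ℝ → ℝ → ℝ) (hψ : Measurable (fun p : ℝ × ℝ => ψ p.1 p.2))
    (hψ2 : Integrable (fun p : ℝ × ℝ => ψ p.1 p.2 ^ 2) (ν.prod ν)) :
    Tendsto (fun n => ∫ x, ∫ y, ψ x y * an n x * bn n y ∂ν ∂ν) atTop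
      (nhds (∫ x, ∫ y, ψ x y * a x * b y ∂ν ∂ν)) := by
  have : IsProbabilityMeasure ν := ⟨hν⟩
  have hrw : ∀ (f h : ℝ → ℝ), ∫ x, ∫ y, ψ x y * f x * h y ∂ν ∂ν
      = ∫ x, f x * ∫ y, h y * ψ x y ∂ν ∂ν := by
    intro f h
    congr 1; ext x
    rw [← integral_const_mul]
    congr 1; ext y; ring
  simp only [hrw]
  have hψs : ∀ x, Measurable (ψ x) := fun x => hψ.comp measurable_prodMk_left
  have hsec : ∀ᵐ x ∂ν, Integrable (fun y => ψ x y ^ 2) ν := hψ2.prod_right_ae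
  have hψ1 : Integrable (fun p : ℝ × ℝ => ψ p.1 p.2) (ν.prod ν) := auxInt _ _ hψ hψ2
  have hKm : ∀ h : ℝ → ℝ, Measurable h → Measurable (fun x => ∫ y, h y * ψ x y ∂ν) := by
    intro h hh
    have : StronglyMeasurable (fun p : ℝ × ℝ => h p.2 * ψ p.1 p.2) :=
      ((hh.comp measurable_snd).mul hψ).stronglyMeasurable
    exact this.integral_prod_right'.measurable
  have hdom : Integrable (fun x => ∫ y, |ψ x y| ∂ν) ν := hψ1.norm.integral_prod_left
  have hKb : ∀ h : ℝ → ℝ, Measurable h → (∀ᵐ x ∂ν, |h x| ≤ 1) →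
      ∀ᵐ x ∂ν, |∫ y, h y * ψ x y ∂ν| ≤ ∫ y, |ψ x y| ∂ν := by
    intro h hh hb1
    filter_upwards [hsec] with x hx
    rw [← Real.norm_eq_abs]
    refine norm_integral_le_of_norm_le (auxInt ν _ (hψs x) hx).abs ?_
    filter_upwards [hb1] with y hy
    rw [norm_mul, Real.norm_eq_abs, Real.norm_eq_abs]
    exact mul_le_of_le_one_left (abs_nonneg _) hy
  have hKi : ∀ h : ℝ → ℝ, Measurable h → (∀ᵐ x ∂ν, |h x| ≤ 1) →
      Integrable (fun x => ∫ y, h y * ψ x y ∂ν) ν := fun h hh hb1 =>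
    Integrable.mono' hdom (hKm h hh).aestronglyMeasurable (hKb h hh hb1)
  have hK2 : Integrable (fun x => (∫ y, b y * ψ x y ∂ν) ^ 2) ν := by
    refine Integrable.mono' hψ2.integral_prod_left
      ((hKm b hbm').pow_const 2).aestronglyMeasurable ?_
    filter_upwards [hsec, hKb b hbm' hbb'] with x hx hk
    have hi := auxInt ν _ (hψs x) hx
    rw [Real.norm_eq_abs, abs_of_nonneg (sq_nonneg _)]
    set k := ∫ y, |ψ x y| ∂ν with hkdef
    have h0 : 0 ≤ ∫ y, (|ψ x y| - k) ^ 2 ∂ν := integral_nonneg fun y => sq_nonneg _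
    have h1 : ∫ y, (|ψ x y| - k) ^ 2 ∂ν = (∫ y, ψ x y ^ 2 ∂ν) - 2 * k * k + k ^ 2 := by
      have e : ∀ y, (|ψ x y| - k) ^ 2 = ψ x y ^ 2 - 2 * k * |ψ x y| + k ^ 2 := by
        intro y; rw [sub_sq, sq_abs]; ring
      simp only [e]
      have hi2 : Integrable (fun y => ψ x y ^ 2 - 2 * k * |ψ x y|) ν :=
        hx.sub (hi.abs.const_mul _)
      rw [integral_add hi2 (integrable_const _),
        integral_sub hx (hi.abs.const_mul _), integral_const_mul]
      simp [hkdef]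
    have h2 : (∫ y, b y * ψ x y ∂ν) ^ 2 ≤ k ^ 2 := by
      rw [← sq_abs]; gcongr
    show _ ≤ ∫ y, ψ x y ^ 2 ∂ν
    nlinarith
  have hmain := ha _ (hKm b hbm') hK2
  have hL1 : Tendsto (fun n => ∫ x, an n x * ((∫ y, bn n y * ψ x y ∂ν) - ∫ y, b y * ψ x y ∂ν) ∂ν)
      atTop (nhds 0) := by
    have h0 : (0:ℝ) = ∫ x, (0:ℝ) ∂ν := by simp
    rw [h0]
    refine tendsto_integral_of_dominated_convergence
      (fun x => (∫ y, |ψ x y| ∂ν) + ∫ y, |ψ x y| ∂ν) ?_ (hdom.add hdom) ?_ ?_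
    · intro n
      exact ((ham n).mul ((hKm _ (hbm n)).sub (hKm _ hbm'))).aestronglyMeasurable
    · intro n
      filter_upwards [hab n, hKb _ (hbm n) (hbb n), hKb _ hbm' hbb'] with x h1 h2 h3
      rw [norm_mul, Real.norm_eq_abs, Real.norm_eq_abs]
      exact (mul_le_of_le_one_left (abs_nonneg _) h1).trans
        ((abs_sub _ _).trans (add_le_add h2 h3))
    · filter_upwards [hsec, ae_all_iff.2 hab] with x hx h1
      have h2 := hb (ψ x) (hψs x) hx
      have h3 := (tendsto_sub_nhds_zero_iff.2 h2).norm
      rw [norm_zero] at h3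
      refine squeeze_zero_norm (fun n => ?_) h3
      rw [norm_mul]
      exact mul_le_of_le_one_left (norm_nonneg _) (h1 n)
  have := hL1.add hmain
  rw [zero_add] at this
  refine this.congr fun n => ?_
  rw [← integral_add]
  · congr 1; ext x; ring
  · exact auxMul ν _ _ (ham n) (hab n) ((hKi _ (hbm n) (hbb n)).sub (hKi _ hbm' hbb'))
  · exact auxMul ν _ _ (ham n) (hab n) (hKi _ hbm' hbb')

lemma coreA' (T : ℝ) (hT : 0 < T) (C : ℝ) (hC : 0 < C) (un : ℕ → ℝ → ℝ → ℝ) (u : ℝ → ℝ → ℝ)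
    (hm : ∀ n, Measurable (fun p : ℝ × ℝ => un n p.1 p.2))
    (hm' : Measurable (fun p : ℝ × ℝ => u p.1 p.2))
    (hb : ∀ n, ∀ t ∈ Icc 0 T, ∀ x ∈ Icc (0:ℝ) 1, un n t x ∈ Icc (0:ℝ) 1)
    (hb' : ∀ t ∈ Icc 0 T, ∀ x ∈ Icc (0:ℝ) 1, u t x ∈ Icc (0:ℝ) 1)
    (hh : ∀ n, ∀ t ∈ Icc 0 T, ∀ τ ∈ Icc 0 T, L2dist (un n t) (un n τ) ≤ C * √|t - τ|)
    (hh' : ∀ t ∈ Icc 0 T, ∀ τ ∈ Icc 0 T, L2dist (u t) (u τ) ≤ C * √|t - τ|)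
    (hweak : ∀ g : ℝ → ℝ → ℝ,
      IntegrableOn (fun p : ℝ × ℝ => g p.1 p.2)
        (Set.Icc 0 T ×ˢ Set.Icc (0:ℝ) 1) (volume : Measure (ℝ × ℝ)) →
      Tendsto (fun n => ∫ p in (Set.Icc 0 T ×ˢ Set.Icc (0:ℝ) 1),
          un n p.1 p.2 * g p.1 p.2 ∂(volume : Measure (ℝ × ℝ))) atTop
        (nhds (∫ p in (Set.Icc 0 T ×ˢ Set.Icc (0:ℝ) 1),
          u p.1 p.2 * g p.1 p.2 ∂(volume : Measure (ℝ × ℝ)))))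
    (t : ℝ) (ht : t ∈ Icc 0 T) (g : ℝ → ℝ) (hg : Measurable g)
    (hg2 : IntegrableOn (fun x => g x ^ 2) (Icc (0:ℝ) 1)) :
    Tendsto (fun n => ∫ x in Icc (0:ℝ) 1, un n t x * g x) atTop
      (nhds (∫ x in Icc (0:ℝ) 1, u t x * g x)) := by
  have habs : ∀ z ∈ Icc (0:ℝ) 1, |z| ≤ 1 := fun z hz => by
    rw [abs_of_nonneg hz.1]; exact hz.2
  have hsq : ∀ (f h : ℝ → ℝ) (d : ℝ), L2dist f h ≤ C * √|d| →
      ∫ x in Icc (0:ℝ) 1, (f x - h x) ^ 2 ≤ C ^ 2 * |d| := by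
    intro f h d hd
    have h0 : 0 ≤ ∫ x in Icc (0:ℝ) 1, (f x - h x) ^ 2 := integral_nonneg fun x => sq_nonneg _
    have : L2dist f h ^ 2 ≤ (C * √|d|) ^ 2 := by
      have : 0 ≤ L2dist f h := Real.sqrt_nonneg _
      gcongr
    rwa [L2dist, Real.sq_sqrt h0, mul_pow, Real.sq_sqrt (abs_nonneg _)] at this
  have hms : ∀ n t, Measurable (un n t) := fun n t => (hm n).comp measurable_prodMk_left
  have hms' : ∀ t, Measurable (u t) := fun t => hm'.comp measurable_prodMk_left
  have hsqi : ∀ f h : ℝ → ℝ, Measurable f → Measurable h → (∀ x ∈ Icc (0:ℝ) 1, f x ∈ Icc (0:ℝ) 1) →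
      (∀ x ∈ Icc (0:ℝ) 1, h x ∈ Icc (0:ℝ) 1) →
      IntegrableOn (fun x => (f x - h x) ^ 2) (Icc (0:ℝ) 1) := by
    intro f h hf hh hf1 hh1
    refine Integrable.mono' (integrable_const (1:ℝ))
        ((hf.sub hh).pow_const 2).aestronglyMeasurable ?_
    filter_upwards [ae_restrict_mem measurableSet_Icc] with x hx
    have h1 := hf1 x hx
    have h2 := hh1 x hx
    rw [Real.norm_eq_abs, abs_of_nonneg (sq_nonneg _)]
    nlinarith [h1.1, h1.2, h2.1, h2.2]
  have hgi : Integrable g (volume.restrict (Icc (0:ℝ) 1)) := auxInt _ g hg hg2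
  have key := coreA T hT (4 * C ^ 2) (by positivity) (fun n t x => un n t x - u t x)
    (fun n => (hm n).sub hm') ?_ ?_ ?_ t ht g hg hg2
  · rw [← tendsto_sub_nhds_zero_iff]
    refine key.congr fun n => ?_
    rw [← integral_sub]
    · simp only [sub_mul]
    · refine auxMul _ _ _ (hms n t) ?_ hgi
      filter_upwards [ae_restrict_mem measurableSet_Icc] with x hx using habs _ (hb n t ht x hx)
    · refine auxMul _ _ _ (hms' t) ?_ hgi
      filter_upwards [ae_restrict_mem measurableSet_Icc] with x hx using habs _ (hb' t ht x hx)
  · intro n t ht x hx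
    have h1 := hb n t ht x hx
    have h2 := hb' t ht x hx
    rw [abs_le]; constructor <;> linarith [h1.1, h1.2, h2.1, h2.2]
  · intro n t ht τ hτ
    have i1 := hsqi _ _ (hms n t) (hms n τ) (hb n t ht) (hb n τ hτ)
    have i2 := hsqi _ _ (hms' t) (hms' τ) (hb' t ht) (hb' τ hτ)
    calc ∫ x in Icc (0:ℝ) 1, (un n t x - u t x - (un n τ x - u τ x)) ^ 2
        ≤ ∫ x in Icc (0:ℝ) 1, (2 * (un n t x - un n τ x) ^ 2 + 2 * (u t x - u τ x) ^ 2) := by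
          refine integral_mono_of_nonneg (Eventually.of_forall fun x => sq_nonneg _)
            ((i1.const_mul 2).add (i2.const_mul 2)) (Eventually.of_forall fun x => ?_)
          simp only
          nlinarith [sq_nonneg ((un n t x - un n τ x) + (u t x - u τ x))]
      _ = 2 * (∫ x in Icc (0:ℝ) 1, (un n t x - un n τ x) ^ 2)
          + 2 * ∫ x in Icc (0:ℝ) 1, (u t x - u τ x) ^ 2 := by
          rw [integral_add (i1.const_mul 2) (i2.const_mul 2), integral_const_mul,
            integral_const_mul]
      _ ≤ _ := by
          linarith [hsq _ _ _ (hh n t ht τ hτ), hsq _ _ _ (hh' t ht τ hτ)]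
  · intro g hg
    refine (tendsto_sub_nhds_zero_iff.2 (hweak g hg)).congr fun n => ?_
    rw [← integral_sub]
    · simp only [sub_mul]
    · refine auxMul _ _ (fun p : ℝ × ℝ => un n p.1 p.2) (hm n) ?_ hg
      filter_upwards [ae_restrict_mem (measurableSet_Icc.prod measurableSet_Icc)] with p hp
      exact habs _ (hb n _ hp.1 _ hp.2)
    · refine auxMul _ _ (fun p : ℝ × ℝ => u p.1 p.2) hm' ?_ hg
      filter_upwards [ae_restrict_mem (measurableSet_Icc.prod measurableSet_Icc)] with p hp
      exact habs _ (hb' _ hp.1 _ hp.2)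

/-- weak* convergence of products under uniform `L²`-Hölder continuity in time
(Step 1A in the proof of Theorem 1.2). -/
theorem product_weakstar_convergence
    (T : ℝ) (hT : 0 < T) (C : ℝ) (hC : 0 < C)
    (sn inn : ℕ → ℝ → ℝ → ℝ) (s i : ℝ → ℝ → ℝ)
    (hsnm : ∀ n, Measurable (fun p : ℝ × ℝ => sn n p.1 p.2))
    (hinm : ∀ n, Measurable (fun p : ℝ × ℝ => inn n p.1 p.2))
    (hsm : Measurable (fun p : ℝ × ℝ => s p.1 p.2))
    (him : Measurable (fun p : ℝ × ℝ => i p.1 p.2))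
    (hsnb : ∀ n t x, t ∈ Set.Icc 0 T → x ∈ Set.Icc (0:ℝ) 1 →
      sn n t x ∈ Set.Icc (0:ℝ) 1 ∧ inn n t x ∈ Set.Icc (0:ℝ) 1)
    (hsb : ∀ t x, t ∈ Set.Icc 0 T → x ∈ Set.Icc (0:ℝ) 1 →
      s t x ∈ Set.Icc (0:ℝ) 1 ∧ i t x ∈ Set.Icc (0:ℝ) 1)
    (hsnhold : ∀ n, ∀ t ∈ Set.Icc 0 T, ∀ τ ∈ Set.Icc 0 T,
      L2dist (sn n t) (sn n τ) ≤ C * Real.sqrt |t - τ| ∧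
      L2dist (inn n t) (inn n τ) ≤ C * Real.sqrt |t - τ|)
    (hshold : ∀ t ∈ Set.Icc 0 T, ∀ τ ∈ Set.Icc 0 T,
      L2dist (s t) (s τ) ≤ C * Real.sqrt |t - τ| ∧
      L2dist (i t) (i τ) ≤ C * Real.sqrt |t - τ|)
    (hweak : ∀ g : ℝ → ℝ → ℝ,
      IntegrableOn (fun p : ℝ × ℝ => g p.1 p.2)
        (Set.Icc 0 T ×ˢ Set.Icc (0:ℝ) 1) (volume : Measure (ℝ × ℝ)) →
      Tendsto (fun n => ∫ p in (Set.Icc 0 T ×ˢ Set.Icc (0:ℝ) 1),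
          sn n p.1 p.2 * g p.1 p.2 ∂(volume : Measure (ℝ × ℝ))) atTop
        (nhds (∫ p in (Set.Icc 0 T ×ˢ Set.Icc (0:ℝ) 1),
          s p.1 p.2 * g p.1 p.2 ∂(volume : Measure (ℝ × ℝ)))) ∧
      Tendsto (fun n => ∫ p in (Set.Icc 0 T ×ˢ Set.Icc (0:ℝ) 1),
          inn n p.1 p.2 * g p.1 p.2 ∂(volume : Measure (ℝ × ℝ))) atTop
        (nhds (∫ p in (Set.Icc 0 T ×ˢ Set.Icc (0:ℝ) 1),
          i p.1 p.2 * g p.1 p.2 ∂(volume : Measure (ℝ × ℝ))))) :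
    ∀ ψ : ℝ → ℝ → ℝ → ℝ,
      Measurable (fun q : ℝ × ℝ × ℝ => ψ q.1 q.2.1 q.2.2) →
      IntegrableOn (fun q : ℝ × ℝ × ℝ => (ψ q.1 q.2.1 q.2.2) ^ 2)
        (Set.Icc 0 T ×ˢ Set.Icc (0:ℝ) 1 ×ˢ Set.Icc (0:ℝ) 1)
        (volume : Measure (ℝ × ℝ × ℝ)) →
      Tendsto (fun n => ∫ t in Set.Icc 0 T, ∫ x in Set.Icc (0:ℝ) 1,
          ∫ y in Set.Icc (0:ℝ) 1, ψ t x y * sn n t x * inn n t y) atTop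
        (nhds (∫ t in Set.Icc 0 T, ∫ x in Set.Icc (0:ℝ) 1,
          ∫ y in Set.Icc (0:ℝ) 1, ψ t x y * s t x * i t y)) := by
  intro ψ hψ hψ2
  set ν : Measure ℝ := volume.restrict (Icc (0:ℝ) 1) with hνdef
  set μ : Measure ℝ := volume.restrict (Icc (0:ℝ) T) with hμdef
  have habs : ∀ z ∈ Icc (0:ℝ) 1, |z| ≤ 1 := fun z hz => by
    rw [abs_of_nonneg hz.1]; exact hz.2
  have hψ2' : Integrable (fun q : ℝ × ℝ × ℝ => (ψ q.1 q.2.1 q.2.2) ^ 2) (μ.prod (ν.prod ν)) := by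
    rw [IntegrableOn, Measure.volume_eq_prod, ← Measure.prod_restrict, Measure.volume_eq_prod,
      ← Measure.prod_restrict] at hψ2
    exact hψ2
  have hψ1 := auxInt _ _ hψ hψ2'
  have hψs : ∀ t, Measurable (fun q : ℝ × ℝ => ψ t q.1 q.2) := fun t =>
    hψ.comp measurable_prodMk_left
  have hsec : ∀ᵐ t ∂μ, Integrable (fun q : ℝ × ℝ => ψ t q.1 q.2 ^ 2) (ν.prod ν) :=
    hψ2'.prod_right_ae
  have hdom : Integrable (fun t => ∫ q : ℝ × ℝ, |ψ t q.1 q.2| ∂(ν.prod ν)) μ :=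
    hψ1.norm.integral_prod_left
  have hmem : ∀ᵐ t ∂μ, t ∈ Icc 0 T := ae_restrict_mem measurableSet_Icc
  have hmem1 : ∀ᵐ x ∂ν, x ∈ Icc (0:ℝ) 1 := ae_restrict_mem measurableSet_Icc
  have hmem2 : ∀ᵐ q : ℝ × ℝ ∂(ν.prod ν), q ∈ Icc (0:ℝ) 1 ×ˢ Icc (0:ℝ) 1 := by
    rw [hνdef, Measure.prod_restrict]
    exact ae_restrict_mem (measurableSet_Icc.prod measurableSet_Icc)
  refine tendsto_integral_of_dominated_convergence _ ?_ hdom ?_ ?_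
  · intro n
    have h1 : StronglyMeasurable (fun q : (ℝ × ℝ) × ℝ =>
        ψ q.1.1 q.1.2 q.2 * sn n q.1.1 q.1.2 * inn n q.1.1 q.2) := by
      refine Measurable.stronglyMeasurable (Measurable.mul (Measurable.mul ?_ ?_) ?_)
      · exact hψ.comp (by fun_prop : Measurable fun q : (ℝ × ℝ) × ℝ => (q.1.1, q.1.2, q.2))
      · exact (hsnm n).comp measurable_fst
      · exact (hinm n).comp (by fun_prop : Measurable fun q : (ℝ × ℝ) × ℝ => (q.1.1, q.2))
    exact (h1.integral_prod_right' (ν := ν)).integral_prod_right' (ν := ν)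
      |>.aestronglyMeasurable
  · intro n
    filter_upwards [hsec, hmem] with t ht htm
    have hi := auxInt _ _ (hψs t) ht
    have hm : Measurable fun q : ℝ × ℝ => ψ t q.1 q.2 * sn n t q.1 * inn n t q.2 := by
      refine ((hψs t).mul ?_).mul ?_
      · exact (hsnm n).comp (by fun_prop : Measurable fun q : ℝ × ℝ => (t, q.1))
      · exact (hinm n).comp (by fun_prop : Measurable fun q : ℝ × ℝ => (t, q.2))
    have hbd : ∀ᵐ q : ℝ × ℝ ∂(ν.prod ν),
        ‖ψ t q.1 q.2 * sn n t q.1 * inn n t q.2‖ ≤ |ψ t q.1 q.2| := by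
      filter_upwards [hmem2] with q hq
      rw [norm_mul, norm_mul, Real.norm_eq_abs, Real.norm_eq_abs, Real.norm_eq_abs]
      have h1 := habs _ (hsnb n t q.1 htm hq.1).1
      have h2 := habs _ (hsnb n t q.2 htm hq.2).2
      exact (mul_le_of_le_one_right (by positivity) h2).trans
        (mul_le_of_le_one_right (by positivity) h1)
    have hint := Integrable.mono' hi.abs hm.aestronglyMeasurable hbd
    have := integral_prod _ hint
    simp only at this
    rw [← this]
    exact norm_integral_le_of_norm_le hi.abs hbd
  · filter_upwards [hsec, hmem] with t ht htm
    refine coreB ν (by simp [hνdef]) (fun n => sn n t) (fun n => inn n t) (s t) (i t)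
      (fun n => (hsnm n).comp measurable_prodMk_left)
      (fun n => (hinm n).comp measurable_prodMk_left)
      (hsm.comp measurable_prodMk_left) (him.comp measurable_prodMk_left) ?_ ?_ ?_ ?_ ?_ ?_
      (ψ t) (hψs t) ht
    · intro n; filter_upwards [hmem1] with x hx using habs _ (hsnb n t x htm hx).1
    · intro n; filter_upwards [hmem1] with x hx using habs _ (hsnb n t x htm hx).2
    · filter_upwards [hmem1] with x hx using habs _ (hsb t x htm hx).1
    · filter_upwards [hmem1] with x hx using habs _ (hsb t x htm hx).2
    · exact coreA' T hT C hC sn s hsnm hsm (fun n t ht x hx => (hsnb n t x ht hx).1)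
        (fun t ht x hx => (hsb t x ht hx).1) (fun n t ht τ hτ => (hsnhold n t ht τ hτ).1)
        (fun t ht τ hτ => (hshold t ht τ hτ).1) (fun g hg => (hweak g hg).1) t htm
    · exact coreA' T hT C hC inn i hinm him (fun n t ht x hx => (hsnb n t x ht hx).2)
        (fun t ht x hx => (hsb t x ht hx).2) (fun n t ht τ hτ => (hsnhold n t ht τ hτ).2)
        (fun t ht τ hτ => (hshold t ht τ hτ).2) (fun g hg => (hweak g hg).2) t htm

end
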